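/- arXiv:2302.03811 — 10 statements merged into one kernel-verified Lean document; each statement's English description precedes it below -/
import Mathlib

section
/- For every state i, action a, and strictly positive vector v : S → ℝ, the following identity holds: e^{α d(i,a)} Σ_{j∈S} Q(j|i,a) v(j) = (1-κ) e^{α c(i,a)} Σ_{j∈S} P(j|i,a) v(j) + κ v(i). Consequently, for every state i, min_{a∈A} e^{α d(i,a)} Σ_{j∈S} Q(j|i,a) v(j) = (1-κ) min_{a∈A} e^{α c(i,a)} Σ_{j∈S} P(j|i,a) v(j) + κ v(i), so the set of actions attaining the minimum is the same for the original and the transformed problem. -/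
/-- A nonnegative affine map commutes with the infimum of a finite family of reals. -/
theorem ciInf_mul_add_of_nonneg {ι : Type*} [Finite ι] [Nonempty ι] {r : ℝ} (hr : 0 ≤ r)
    (f : ι → ℝ) (b : ℝ) : (⨅ i, (r * f i + b)) = r * (⨅ i, f i) + b := by
  rw [Real.mul_iInf_of_nonneg hr, ciInf_add (Set.finite_range _).bddBelow]

/-- For every state `i`, action `a`, and strictly positive vector `v : S → ℝ`,
`e^{α d(i,a)} Σ_j Q(j|i,a) v(j) = (1-κ) e^{α c(i,a)} Σ_j P(j|i,a) v(j) + κ v(i)`.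
Consequently the minima over actions satisfy the corresponding identity, and the set of
actions attaining the minimum is the same for the original and the transformed problem. -/
theorem transformed_bellman_identity
    {S A : Type*} [Fintype S] [Fintype A] [Nonempty S] [Nonempty A] [DecidableEq S]
    (P : S → A → S → ℝ) (c : S → A → ℝ) (α κ : ℝ)
    (hα : 0 < α) (hκ0 : 0 < κ) (hκ1 : κ < 1)
    (hP0 : ∀ i a j, 0 ≤ P i a j) (hP1 : ∀ i a, ∑ j, P i a j = 1)
    (d : S → A → ℝ) (Q : S → A → S → ℝ)
    (hd : ∀ i a, d i a = (1 / α) * Real.log ((1 - κ) * Real.exp (α * c i a) + κ))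
    (hQ : ∀ i a j, Q i a j =
      ((1 - κ) * Real.exp (α * c i a) * P i a j + κ * (if i = j then 1 else 0)) /
        ((1 - κ) * Real.exp (α * c i a) + κ))
    (v : S → ℝ) (hv : ∀ i, 0 < v i) :
    (∀ i a, Real.exp (α * d i a) * ∑ j, Q i a j * v j =
      (1 - κ) * (Real.exp (α * c i a) * ∑ j, P i a j * v j) + κ * v i) ∧
    (∀ i, (⨅ a : A, Real.exp (α * d i a) * ∑ j, Q i a j * v j) =
      (1 - κ) * (⨅ a : A, Real.exp (α * c i a) * ∑ j, P i a j * v j) + κ * v i) ∧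
    (∀ i, {a : A | Real.exp (α * d i a) * ∑ j, Q i a j * v j =
        ⨅ a' : A, Real.exp (α * d i a') * ∑ j, Q i a' j * v j} =
      {a : A | Real.exp (α * c i a) * ∑ j, P i a j * v j =
        ⨅ a' : A, Real.exp (α * c i a') * ∑ j, P i a' j * v j}) := by
  have bellman : ∀ i a, Real.exp (α * d i a) * ∑ j, Q i a j * v j =
      (1 - κ) * (Real.exp (α * c i a) * ∑ j, P i a j * v j) + κ * v i := by
    intro i a
    have hpos : 0 < (1 - κ) * Real.exp (α * c i a) + κ :=
      add_pos (mul_pos (sub_pos.2 hκ1) (Real.exp_pos _)) hκ0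
    have hexp : Real.exp (α * d i a) = (1 - κ) * Real.exp (α * c i a) + κ := by
      rw [hd, ← mul_assoc, mul_one_div_cancel hα.ne', one_mul, Real.exp_log hpos]
    have hterm : ∀ j, ((1 - κ) * Real.exp (α * c i a) + κ) * (Q i a j * v j) =
        (1 - κ) * (Real.exp (α * c i a) * (P i a j * v j)) +
          κ * (if i = j then v j else 0) := by
      intro j
      rw [hQ, ← mul_assoc, mul_div_cancel₀ _ hpos.ne']
      split_ifs <;> ring
    rw [hexp, Finset.mul_sum, Finset.sum_congr rfl fun j _ => hterm j, Finset.sum_add_distrib,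
      ← Finset.mul_sum, ← Finset.mul_sum, ← Finset.mul_sum, Finset.sum_ite_eq,
      if_pos (Finset.mem_univ i)]
  have bellman_min : ∀ i, (⨅ a : A, Real.exp (α * d i a) * ∑ j, Q i a j * v j) =
      (1 - κ) * (⨅ a : A, Real.exp (α * c i a) * ∑ j, P i a j * v j) + κ * v i := by
    intro i
    simp only [bellman]
    exact ciInf_mul_add_of_nonneg (sub_pos.2 hκ1).le _ _
  refine ⟨bellman, bellman_min, fun i => ?_⟩
  ext a
  rw [Set.mem_ofPred_eq, Set.mem_ofPred_eq, bellman_min, bellman, add_left_inj,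
    mul_right_inj' (sub_pos.2 hκ1).ne']
end

section
/- (Theorem 1, part 1) Suppose Λ* ∈ ℝ and V* : S → ℝ satisfy the multiplicative Bellman optimality equation for the original problem: e^{Λ*} e^{V*(i)} = min_{a∈A} e^{α c(i,a)} Σ_{j∈S} P(j|i,a) e^{V*(j)} for all i ∈ S. Define Λ̃* = log((1-κ)e^{Λ*} + κ). Then (Λ̃*, V*) satisfies the multiplicative Bellman optimality equation for the transformed problem: e^{Λ̃*} e^{V*(i)} = min_{a∈A} e^{α d(i,a)} Σ_{j∈S} Q(j|i,a) e^{V*(j)} for all i ∈ S. -/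
/-- Clearing the normalizing denominator of a lazy kernel `(w p + κ 1{i = ·}) / (w + κ)`. -/
lemma mul_sum_lazy_kernel {S : Type*} [Fintype S] [DecidableEq S] (p f : S → ℝ) (i : S)
    {w κ : ℝ} (h : w + κ ≠ 0) :
    (w + κ) * ∑ j, (w * p j + κ * (if i = j then 1 else 0)) / (w + κ) * f j =
      w * ∑ j, p j * f j + κ * f i := by
  have hterm (j : S) : (w + κ) * ((w * p j + κ * (if i = j then 1 else 0)) / (w + κ) * f j) =
      w * (p j * f j) + if i = j then κ * f j else 0 := by
    rw [← mul_assoc, mul_div_cancel₀ _ h]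
    split_ifs <;> ring
  simp only [Finset.mul_sum, hterm, Finset.sum_add_distrib, Finset.sum_ite_eq,
    Finset.mem_univ, if_true]

/-- An increasing affine map commutes with the infimum of a finite nonempty family. -/
lemma mul_ciInf_add_of_finite {ι : Type*} [Finite ι] [Nonempty ι] (f : ι → ℝ) {r : ℝ}
    (hr : 0 ≤ r) (s : ℝ) : r * (⨅ k, f k) + s = ⨅ k, (r * f k + s) :=
  Monotone.map_ciInf_of_continuousAt (f := fun x => r * x + s) (by fun_prop)
    (fun _ _ h => by dsimp only; gcongr) (Set.finite_range f).bddBelow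


/-- Theorem 1, part 1: a solution `(Λ*, V*)` of the multiplicative Bellman optimality
equation for the original problem yields, with `Λ̃* = log((1-κ)e^{Λ*} + κ)`, a solution
`(Λ̃*, V*)` of the multiplicative Bellman optimality equation for the transformed problem. -/
theorem transformed_bellman_forward
    {S A : Type*} [Fintype S] [Fintype A] [Nonempty S] [Nonempty A] [DecidableEq S]
    (P : S → A → S → ℝ) (c : S → A → ℝ) (α κ : ℝ)
    (hα : 0 < α) (hκ0 : 0 < κ) (hκ1 : κ < 1)
    (hP0 : ∀ i a j, 0 ≤ P i a j) (hP1 : ∀ i a, ∑ j, P i a j = 1)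
    (d : S → A → ℝ) (Q : S → A → S → ℝ)
    (hd : ∀ i a, d i a = (1 / α) * Real.log ((1 - κ) * Real.exp (α * c i a) + κ))
    (hQ : ∀ i a j, Q i a j =
      ((1 - κ) * Real.exp (α * c i a) * P i a j + κ * (if i = j then 1 else 0)) /
        ((1 - κ) * Real.exp (α * c i a) + κ))
    (Λ : ℝ) (V : S → ℝ)
    (hopt : ∀ i, Real.exp Λ * Real.exp (V i) =
      ⨅ a : A, Real.exp (α * c i a) * ∑ j, P i a j * Real.exp (V j)) :
    ∀ i, Real.exp (Real.log ((1 - κ) * Real.exp Λ + κ)) * Real.exp (V i) =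
      ⨅ a : A, Real.exp (α * d i a) * ∑ j, Q i a j * Real.exp (V j) := by
  intro i
  have hκ : 0 < 1 - κ := sub_pos.mpr hκ1
  have hstep (a : A) : Real.exp (α * d i a) * ∑ j, Q i a j * Real.exp (V j) =
      (1 - κ) * (Real.exp (α * c i a) * ∑ j, P i a j * Real.exp (V j)) +
        κ * Real.exp (V i) := by
    have hpos : 0 < (1 - κ) * Real.exp (α * c i a) + κ := by positivity
    rw [hd, ← mul_assoc, mul_one_div_cancel hα.ne', one_mul, Real.exp_log hpos]
    simp only [hQ]
    rw [mul_sum_lazy_kernel _ _ _ hpos.ne', mul_assoc]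
  simp only [hstep]
  rw [← mul_ciInf_add_of_finite _ hκ.le, ← hopt i, Real.exp_log (by positivity)]
  ring
end

section
/- (Theorem 1, part 2, first claim) Suppose Λ̃* ∈ ℝ and V* : S → ℝ satisfy the multiplicative Bellman optimality equation for the transformed problem: e^{Λ̃*} e^{V*(i)} = min_{a∈A} e^{α d(i,a)} Σ_{j∈S} Q(j|i,a) e^{V*(j)} for all i ∈ S. Then e^{Λ̃*} ≥ κ. -/
/-- Theorem 1, part 2, first claim: if `(Λ̃*, V*)` solves the multiplicative Bellman
optimality equation for the transformed problem, then `e^{Λ̃*} ≥ κ`. -/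
theorem transformed_bellman_lambda_ge_kappa
    {S A : Type*} [Fintype S] [Fintype A] [Nonempty S] [Nonempty A] [DecidableEq S]
    (P : S → A → S → ℝ) (c : S → A → ℝ) (α κ : ℝ)
    (hα : 0 < α) (hκ0 : 0 < κ) (hκ1 : κ < 1)
    (hP0 : ∀ i a j, 0 ≤ P i a j) (hP1 : ∀ i a, ∑ j, P i a j = 1)
    (d : S → A → ℝ) (Q : S → A → S → ℝ)
    (hd : ∀ i a, d i a = (1 / α) * Real.log ((1 - κ) * Real.exp (α * c i a) + κ))
    (hQ : ∀ i a j, Q i a j =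
      ((1 - κ) * Real.exp (α * c i a) * P i a j + κ * (if i = j then 1 else 0)) /
        ((1 - κ) * Real.exp (α * c i a) + κ))
    (Λt : ℝ) (V : S → ℝ)
    (hopt : ∀ i, Real.exp Λt * Real.exp (V i) =
      ⨅ a : A, Real.exp (α * d i a) * ∑ j, Q i a j * Real.exp (V j)) :
    κ ≤ Real.exp Λt := by
  obtain ⟨i⟩ := ‹Nonempty S›
  refine le_of_mul_le_mul_right ?_ (Real.exp_pos (V i))
  rw [hopt i]
  refine le_ciInf fun a => ?_
  have hw : 0 ≤ (1 - κ) * Real.exp (α * c i a) :=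
    mul_nonneg (by linarith) (Real.exp_pos _).le
  have hD : 0 < (1 - κ) * Real.exp (α * c i a) + κ := by linarith
  have hexp : Real.exp (α * d i a) = (1 - κ) * Real.exp (α * c i a) + κ := by
    rw [hd, ← mul_assoc, mul_one_div_cancel hα.ne', one_mul, Real.exp_log hD]
  have hQ0 : ∀ j, 0 ≤ Q i a j := fun j => by
    rw [hQ]
    refine div_nonneg (add_nonneg (mul_nonneg hw (hP0 i a j)) ?_) hD.le
    split_ifs <;> linarith
  have hdiag : κ ≤ Real.exp (α * d i a) * Q i a i := by
    rw [hexp, hQ, mul_div_cancel₀ _ hD.ne', if_pos rfl]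
    linarith [mul_nonneg hw (hP0 i a i)]
  calc κ * Real.exp (V i)
      ≤ Real.exp (α * d i a) * Q i a i * Real.exp (V i) :=
        mul_le_mul_of_nonneg_right hdiag (Real.exp_pos _).le
    _ = Real.exp (α * d i a) * (Q i a i * Real.exp (V i)) := mul_assoc _ _ _
    _ ≤ Real.exp (α * d i a) * ∑ j, Q i a j * Real.exp (V j) :=
        mul_le_mul_of_nonneg_left
          (Finset.single_le_sum (f := fun j => Q i a j * Real.exp (V j))
            (fun j _ => mul_nonneg (hQ0 j) (Real.exp_pos _).le) (Finset.mem_univ i))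
          (Real.exp_pos _).le
end

section
/- (Theorem 1, part 2, second claim) Suppose Λ̃* ∈ ℝ and V* : S → ℝ satisfy the multiplicative Bellman optimality equation for the transformed problem: e^{Λ̃*} e^{V*(i)} = min_{a∈A} e^{α d(i,a)} Σ_{j∈S} Q(j|i,a) e^{V*(j)} for all i ∈ S. Then for all i ∈ S, ((e^{Λ̃*} − κ)/(1 − κ)) · e^{V*(i)} = min_{a∈A} e^{α c(i,a)} Σ_{j∈S} P(j|i,a) e^{V*(j)}; that is, (Λ*, V*) with Λ* = log((e^{Λ̃*} − κ)/(1 − κ)) satisfies the multiplicative Bellman optimality equation for the original problem. -/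
/-- The transformed Bellman operator for a fixed action is the convex combination of the original
one (weight `1 - κ`) and the identity (weight `κ`). -/
theorem transformed_cost_mul_sum_kernel {S : Type*} [Fintype S] [DecidableEq S]
    {α κ : ℝ} (hα : α ≠ 0) (hκ0 : 0 < κ) (hκ1 : κ < 1) (i : S) (c : ℝ) (p v : S → ℝ) :
    Real.exp (α * ((1 / α) * Real.log ((1 - κ) * Real.exp (α * c) + κ))) *
        ∑ j, ((1 - κ) * Real.exp (α * c) * p j + κ * (if i = j then 1 else 0)) /
          ((1 - κ) * Real.exp (α * c) + κ) * v j =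
      (1 - κ) * (Real.exp (α * c) * ∑ j, p j * v j) + κ * v i := by
  have hκ : 0 < 1 - κ := sub_pos.mpr hκ1
  have hD : 0 < (1 - κ) * Real.exp (α * c) + κ := by positivity
  rw [← mul_assoc, mul_one_div_cancel hα, one_mul, Real.exp_log hD, Finset.mul_sum]
  have hterm : ∀ j, ((1 - κ) * Real.exp (α * c) + κ) *
      (((1 - κ) * Real.exp (α * c) * p j + κ * (if i = j then 1 else 0)) /
        ((1 - κ) * Real.exp (α * c) + κ) * v j) =
      (1 - κ) * Real.exp (α * c) * (p j * v j) + κ * (if i = j then v j else 0) := by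
    intro j
    rw [← mul_assoc, mul_div_cancel₀ _ hD.ne']
    split_ifs <;> ring
  simp_rw [hterm]
  rw [Finset.sum_add_distrib, ← Finset.mul_sum, ← Finset.mul_sum, Finset.sum_ite_eq]
  simp [mul_assoc]

/-- Theorem 1, part 2, second claim: if `(Λ̃*, V*)` solves the multiplicative Bellman
optimality equation for the transformed problem, then
`((e^{Λ̃*} − κ)/(1 − κ)) e^{V*(i)} = min_a e^{α c(i,a)} Σ_j P(j|i,a) e^{V*(j)}` for all `i`,
i.e. `(Λ*, V*)` with `Λ* = log((e^{Λ̃*} − κ)/(1 − κ))` solves the original equation. -/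
theorem transformed_bellman_backward
    {S A : Type*} [Fintype S] [Fintype A] [Nonempty S] [Nonempty A] [DecidableEq S]
    (P : S → A → S → ℝ) (c : S → A → ℝ) (α κ : ℝ)
    (hα : 0 < α) (hκ0 : 0 < κ) (hκ1 : κ < 1)
    (hP0 : ∀ i a j, 0 ≤ P i a j) (hP1 : ∀ i a, ∑ j, P i a j = 1)
    (d : S → A → ℝ) (Q : S → A → S → ℝ)
    (hd : ∀ i a, d i a = (1 / α) * Real.log ((1 - κ) * Real.exp (α * c i a) + κ))
    (hQ : ∀ i a j, Q i a j =
      ((1 - κ) * Real.exp (α * c i a) * P i a j + κ * (if i = j then 1 else 0)) /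
        ((1 - κ) * Real.exp (α * c i a) + κ))
    (Λt : ℝ) (V : S → ℝ)
    (hopt : ∀ i, Real.exp Λt * Real.exp (V i) =
      ⨅ a : A, Real.exp (α * d i a) * ∑ j, Q i a j * Real.exp (V j)) :
    ∀ i, ((Real.exp Λt - κ) / (1 - κ)) * Real.exp (V i) =
      ⨅ a : A, Real.exp (α * c i a) * ∑ j, P i a j * Real.exp (V j) := by
  intro i
  have hκ : 0 < 1 - κ := sub_pos.mpr hκ1
  have h := hopt i
  simp_rw [hd, hQ, transformed_cost_mul_sum_kernel hα.ne' hκ0 hκ1] at h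
  rw [← ciInf_add (Set.finite_range _).bddBelow, ← Real.mul_iInf_of_nonneg hκ.le] at h
  rw [div_mul_eq_mul_div, div_eq_iff hκ.ne']
  linarith
end

section
/- (Lemma 2) There exists a finite natural number R such that for every sequence of policies f_1, f_2, …, f_R, every entry of the matrix product Q_{f_1} Q_{f_2} ⋯ Q_{f_R} is strictly positive: min_{i,j∈S} (Q_{f_1} Q_{f_2} ⋯ Q_{f_R})(i,j) > 0. -/
/-- The stochastic matrix of a policy `f`: `(Q_f)(i,j) = Q(j|i,f(i))`. -/
def policyMatrix {S A : Type*} (Q : S → A → S → ℝ) (f : S → A) : Matrix S S ℝ :=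
  Matrix.of fun i j => Q i (f i) j

open scoped Matrix

/-- If no entry of `M` leads from outside `T` into `T`, the same holds for every power of `M`. -/
theorem Matrix.pow_apply_eq_zero_of_forall_notMem {S R : Type*} [Fintype S] [DecidableEq S]
    [Semiring R] {M : Matrix S S R} {T : Set S} (h : ∀ i ∉ T, ∀ k ∈ T, M i k = 0) (n : ℕ) :
    ∀ i ∉ T, ∀ k ∈ T, (M ^ n) i k = 0 := by
  induction n with
  | zero =>
    intro i hi k hk
    rw [pow_zero, Matrix.one_apply_ne]
    rintro rfl
    exact hi hk
  | succ n ih =>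
    intro i hi k hk
    rw [pow_succ, Matrix.mul_apply]
    refine Finset.sum_eq_zero fun l _ => ?_
    by_cases hl : l ∈ T
    · rw [ih i hi l hl, zero_mul]
    · rw [h l hl k hk, mul_zero]

/-- Multiplication by an irreducible nonnegative matrix with positive diagonal strictly enlarges
the set of positive entries of a nonnegative vector, unless that set is empty or everything. -/
theorem Matrix.support_ssubset_support_mulVec {S : Type*} [Fintype S] [DecidableEq S]
    {M : Matrix S S ℝ} (hM : ∀ i j, 0 ≤ M i j) (hdiag : ∀ i, 0 < M i i)
    (hirr : ∀ i j, ∃ k : ℕ, 1 ≤ k ∧ 0 < (M ^ k) i j)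
    {v : S → ℝ} (hv : ∀ i, 0 ≤ v i) (hpos : ∃ i, 0 < v i) (hzero : ∃ i, ¬ 0 < v i) :
    ({i | 0 < v i} : Finset S) ⊂ ({i | 0 < (M *ᵥ v) i} : Finset S) := by
  have key : ∀ i k, 0 < M i k → 0 < v k → 0 < (M *ᵥ v) i := fun i k hik hk =>
    Finset.sum_pos' (fun l _ => mul_nonneg (hM i l) (hv l))
      ⟨k, Finset.mem_univ k, mul_pos hik hk⟩
  rw [Finset.ssubset_iff_of_subset
    (Finset.monotone_filter_right _ fun i _ hi => key i i (hdiag i) hi)]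
  by_contra! hcon
  simp only [Finset.mem_filter, Finset.mem_univ, true_and] at hcon
  obtain ⟨j, hj⟩ := hpos
  obtain ⟨i, hi⟩ := hzero
  obtain ⟨n, -, hn⟩ := hirr i j
  refine hn.ne' (Matrix.pow_apply_eq_zero_of_forall_notMem (T := {i | 0 < v i}) ?_ n i hi j hj)
  intro i hi k hk
  by_contra hne
  exact hi (hcon i (key i k ((hM i k).lt_of_ne' hne) hk))

/-- A column of a product of `n` irreducible nonnegative matrices with positive diagonal has at
least `min (n + 1) (card S)` positive entries. -/
theorem Matrix.min_length_succ_card_le_card_pos_list_prod {S : Type*} [Fintype S] [DecidableEq S]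
    (l : List (Matrix S S ℝ)) (hl : ∀ M ∈ l, (∀ i j, 0 ≤ M i j) ∧ (∀ i, 0 < M i i) ∧
      ∀ i j, ∃ k : ℕ, 1 ≤ k ∧ 0 < (M ^ k) i j) (j : S) :
    (∀ i, 0 ≤ l.prod i j) ∧
      min (l.length + 1) (Fintype.card S) ≤ ({i | 0 < l.prod i j} : Finset S).card := by
  induction l with
  | nil =>
    refine ⟨fun i => ?_, ?_⟩
    · rw [List.prod_nil, Matrix.one_apply]
      split_ifs <;> norm_num
    · refine (min_le_left _ _).trans (Finset.card_pos.2 ⟨j, ?_⟩)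
      rw [Finset.mem_filter, List.prod_nil, Matrix.one_apply_eq]
      exact ⟨Finset.mem_univ j, one_pos⟩
  | cons M l ih =>
    obtain ⟨hM, hdiag, hirr⟩ := hl M (by simp)
    obtain ⟨hnonneg, hcard⟩ := ih fun N hN => hl N (List.mem_cons_of_mem _ hN)
    have hprod : ∀ i, (M :: l).prod i j = (M *ᵥ fun k => l.prod k j) i := fun i => by
      rw [List.prod_cons, Matrix.mul_apply]
      rfl
    simp only [hprod]
    refine ⟨fun i => Finset.sum_nonneg fun k _ => mul_nonneg (hM i k) (hnonneg k), ?_⟩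
    by_cases hall : ∀ i, 0 < l.prod i j
    · refine (min_le_right _ _).trans ?_
      rw [Finset.filter_true_of_mem, Finset.card_univ]
      exact fun i _ => Finset.sum_pos' (fun k _ => mul_nonneg (hM i k) (hnonneg k))
        ⟨i, Finset.mem_univ i, mul_pos (hdiag i) (hall i)⟩
    · have hne : ∃ i, 0 < l.prod i j := by
        have hS : 0 < Fintype.card S := Fintype.card_pos_iff.2 ⟨j⟩
        obtain ⟨i, hi⟩ := Finset.card_pos.1 ((lt_min l.length.succ_pos hS).trans_le hcard)
        exact ⟨i, (Finset.mem_filter.1 hi).2⟩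
      have hlt := Finset.card_lt_card
        (Matrix.support_ssubset_support_mulVec hM hdiag hirr hnonneg hne (not_forall.1 hall))
      rw [List.length_cons]
      omega

/-- Lemma 2: there is a finite `R` such that for every sequence of `R` policies, every
entry of the product `Q_{f_1} Q_{f_2} ⋯ Q_{f_R}` is strictly positive. -/
theorem exists_R_product_positive
    {S A : Type*} [Fintype S] [Fintype A] [Nonempty S] [Nonempty A] [DecidableEq S]
    (Q : S → A → S → ℝ)
    (hQ0 : ∀ i a j, 0 ≤ Q i a j) (hQ1 : ∀ i a, ∑ j, Q i a j = 1)
    (hdiag : ∀ i a, 0 < Q i a i)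
    (hirr : ∀ f : S → A, ∀ i j : S, ∃ k : ℕ, 1 ≤ k ∧ 0 < ((policyMatrix Q f) ^ k) i j) :
    ∃ R : ℕ, 0 < R ∧ ∀ fs : Fin R → (S → A), ∀ i j : S,
      0 < ((List.ofFn fun k => policyMatrix Q (fs k)).prod) i j := by
  refine ⟨Fintype.card S, Fintype.card_pos, fun fs i j => ?_⟩
  have hcard := (Matrix.min_length_succ_card_le_card_pos_list_prod
    (List.ofFn fun k => policyMatrix Q (fs k)) ?_ j).2
  · rw [List.length_ofFn, min_eq_right (Nat.le_succ _)] at hcard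
    have huniv := (Finset.card_eq_iff_eq_univ _).1 (le_antisymm (Finset.card_le_univ _) hcard)
    have hi := Finset.mem_univ i
    rw [← huniv] at hi
    exact (Finset.mem_filter.1 hi).2
  · simp only [List.mem_ofFn]
    rintro _ ⟨k, rfl⟩
    exact ⟨fun i j => hQ0 i _ j, fun i => hdiag i _, hirr (fs k)⟩
end

section
/- (Optimality is a lower bound for every policy) Let (λ*, v*) be a solution of the multiplicative Bellman optimality equation and let f be any policy admitting a Perron pair (λ_f, w). Then λ* ≤ λ_f; that is, the optimal risk-sensitive average cost is no larger than the risk-sensitive average cost of any policy. -/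
/-- Bellman operator of a policy `f`:
`(T_f v)(i) = e^{α d(i,f(i))} Σ_j Q(j|i,f(i)) v(j)`. -/
noncomputable def Tpol {S A : Type*} [Fintype S]
    (Q : S → A → S → ℝ) (d : S → A → ℝ) (α : ℝ) (f : S → A) (v : S → ℝ) (i : S) : ℝ :=
  Real.exp (α * d i (f i)) * ∑ j, Q i (f i) j * v j

/-- Bellman optimality operator:
`(T v)(i) = min_a e^{α d(i,a)} Σ_j Q(j|i,a) v(j)`. -/
noncomputable def Topt {S A : Type*} [Fintype S] [Nonempty A]
    (Q : S → A → S → ℝ) (d : S → A → ℝ) (α : ℝ) (v : S → ℝ) (i : S) : ℝ :=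
  ⨅ a : A, Real.exp (α * d i a) * ∑ j, Q i a j * v j

/-- Collatz–Wielandt comparison: if a nonnegative matrix `M` satisfies `r v ≤ M v` and `M w ≤ s w`
with `v` and `w` strictly positive, then `r ≤ s`. -/
theorem le_of_subeigenvector_of_supereigenvector {S : Type*} [Fintype S] [Nonempty S]
    {M : S → S → ℝ} (hM : ∀ i j, 0 ≤ M i j) {r s : ℝ} {v w : S → ℝ}
    (hv : ∀ i, 0 < v i) (hw : ∀ i, 0 < w i)
    (hrv : ∀ i, r * v i ≤ ∑ j, M i j * v j) (hsw : ∀ i, ∑ j, M i j * w j ≤ s * w i) :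
    r ≤ s := by
  obtain ⟨i, hi⟩ := Finite.exists_max fun i => v i / w i
  have hc : 0 ≤ v i / w i := (div_pos (hv i) (hw i)).le
  refine le_of_mul_le_mul_right ?_ (hv i)
  calc r * v i ≤ ∑ j, M i j * v j := hrv i
    _ ≤ ∑ j, M i j * (v i / w i * w j) :=
      Finset.sum_le_sum fun j _ =>
        mul_le_mul_of_nonneg_left ((div_le_iff₀ (hw j)).mp (hi j)) (hM i j)
    _ = v i / w i * ∑ j, M i j * w j := by
      rw [Finset.mul_sum]
      exact Finset.sum_congr rfl fun j _ => by ring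
    _ ≤ v i / w i * (s * w i) := mul_le_mul_of_nonneg_left (hsw i) hc
    _ = s * v i := by
      have := (hw i).ne'
      field_simp

/-- Optimality is a lower bound for every policy: if `(λ*, v*)` solves the
multiplicative Bellman optimality equation and `(λ_f, w)` is a Perron pair of policy `f`,
then `λ* ≤ λ_f`. -/
theorem optimal_le_policy_cost
    {S A : Type*} [Fintype S] [Fintype A] [Nonempty S] [Nonempty A]
    (Q : S → A → S → ℝ) (d : S → A → ℝ) (α : ℝ) (hα : 0 < α)
    (hQ0 : ∀ i a j, 0 ≤ Q i a j) (hQ1 : ∀ i a, ∑ j, Q i a j = 1)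
    (lamStar : ℝ) (vStar : S → ℝ)
    (hlamStar : 0 < lamStar) (hvStar : ∀ i, 0 < vStar i)
    (hopt : ∀ i, lamStar * vStar i = Topt Q d α vStar i)
    (f : S → A) (lamF : ℝ) (w : S → ℝ)
    (hlamF : 0 < lamF) (hw : ∀ i, 0 < w i)
    (hPerron : ∀ i, ∑ j, (Real.exp (α * d i (f i)) * Q i (f i) j) * w j = lamF * w i) :
    lamStar ≤ lamF := by
  refine le_of_subeigenvector_of_supereigenvector
    (M := fun i j => Real.exp (α * d i (f i)) * Q i (f i) j)
    (fun i j => mul_nonneg (Real.exp_pos _).le (hQ0 _ _ _)) hvStar hw (fun i => ?_)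
    fun i => (hPerron i).le
  rw [hopt i]
  simp only [mul_assoc, ← Finset.mul_sum]
  exact ciInf_le (Set.finite_range _).bddBelow (f i)
end

section
/- (Lemma 3) Let v : S → ℝ be strictly positive, let f be a greedy policy for v, and set ℓ = min_{i∈S} (T v)(i)/v(i) and u = max_{i∈S} (T v)(i)/v(i). Let (λ*, v*) be a solution of the multiplicative Bellman optimality equation and let (λ_f, w) be a Perron pair for f. Then ℓ ≤ λ* ≤ λ_f ≤ u. -/
/-- Collatz–Wielandt comparison: a lower growth rate of the Bellman operator of a policy on one
strictly positive vector is at most any upper growth rate on another. -/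
theorem growth_le_of_mul_le_Tpol_of_Tpol_le_mul {S A : Type*} [Fintype S] [Nonempty S]
    {Q : S → A → S → ℝ} {d : S → A → ℝ} {α : ℝ} (hQ : ∀ i a j, 0 ≤ Q i a j) {f : S → A}
    {x y : S → ℝ} (hx : ∀ i, 0 < x i) (hy : ∀ i, 0 < y i) {b c : ℝ}
    (hb : ∀ i, b * x i ≤ Tpol Q d α f x i) (hc : ∀ i, Tpol Q d α f y i ≤ c * y i) :
    b ≤ c := by
  obtain ⟨i, hi⟩ := Finite.exists_max fun i => x i / y i
  have hr : 0 ≤ x i / y i := (div_pos (hx i) (hy i)).le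
  have hle : ∀ j, x j ≤ x i / y i * y j := fun j => (div_le_iff₀ (hy j)).1 (hi j)
  refine le_of_mul_le_mul_right ?_ (hx i)
  calc
    b * x i ≤ Tpol Q d α f x i := hb i
    _ ≤ Real.exp (α * d i (f i)) * ∑ j, Q i (f i) j * (x i / y i * y j) :=
      mul_le_mul_of_nonneg_left
        (Finset.sum_le_sum fun j _ => mul_le_mul_of_nonneg_left (hle j) (hQ _ _ _))
        (Real.exp_pos _).le
    _ = x i / y i * Tpol Q d α f y i := by
      simp only [Tpol, mul_left_comm _ (x i / y i), ← Finset.mul_sum]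
    _ ≤ x i / y i * (c * y i) := mul_le_mul_of_nonneg_left (hc i) hr
    _ = c * x i := by
      rw [mul_left_comm, div_mul_cancel₀ _ (hy i).ne']

theorem Topt_le_Tpol {S A : Type*} [Fintype S] [Finite A] [Nonempty A]
    (Q : S → A → S → ℝ) (d : S → A → ℝ) (α : ℝ) (f : S → A) (v : S → ℝ) (i : S) :
    Topt Q d α v i ≤ Tpol Q d α f v i :=
  ciInf_le (Set.finite_range _).bddBelow (f i)

theorem exists_greedy_policy {S A : Type*} [Fintype S] [Finite A] [Nonempty A]
    (Q : S → A → S → ℝ) (d : S → A → ℝ) (α : ℝ) (v : S → ℝ) :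
    ∃ f : S → A, ∀ i, Tpol Q d α f v i = Topt Q d α v i := by
  choose f hf using fun i => exists_eq_ciInf_of_finite
    (f := fun a : A => Real.exp (α * d i a) * ∑ j, Q i a j * v j)
  exact ⟨f, hf⟩

/-- Lemma 3: for a strictly positive `v`, a greedy policy `f` for `v`, and
`ℓ = min_i (Tv)(i)/v(i)`, `u = max_i (Tv)(i)/v(i)`, we have `ℓ ≤ λ* ≤ λ_f ≤ u`,
where `(λ*, v*)` solves the multiplicative Bellman optimality equation and
`(λ_f, w)` is a Perron pair for `f`. -/
theorem mpi_sandwich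
    {S A : Type*} [Fintype S] [Fintype A] [Nonempty S] [Nonempty A]
    (Q : S → A → S → ℝ) (d : S → A → ℝ) (α : ℝ) (hα : 0 < α)
    (hQ0 : ∀ i a j, 0 ≤ Q i a j) (hQ1 : ∀ i a, ∑ j, Q i a j = 1)
    (v : S → ℝ) (hv : ∀ i, 0 < v i)
    (f : S → A) (hgreedy : ∀ i, Tpol Q d α f v i = Topt Q d α v i)
    (lamStar : ℝ) (vStar : S → ℝ)
    (hlamStar : 0 < lamStar) (hvStar : ∀ i, 0 < vStar i)
    (hopt : ∀ i, lamStar * vStar i = Topt Q d α vStar i)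
    (lamF : ℝ) (w : S → ℝ)
    (hlamF : 0 < lamF) (hw : ∀ i, 0 < w i)
    (hPerron : ∀ i, ∑ j, (Real.exp (α * d i (f i)) * Q i (f i) j) * w j = lamF * w i) :
    (⨅ i, Topt Q d α v i / v i) ≤ lamStar ∧ lamStar ≤ lamF ∧
      lamF ≤ ⨆ i, Topt Q d α v i / v i := by
  have hF : ∀ i, Tpol Q d α f w i = lamF * w i := fun i => by
    rw [← hPerron i, Tpol, Finset.mul_sum]
    simp only [mul_assoc]
  obtain ⟨g, hg⟩ := exists_greedy_policy Q d α vStar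
  refine ⟨?_, ?_, ?_⟩
  · refine growth_le_of_mul_le_Tpol_of_Tpol_le_mul hQ0 hv hvStar (f := g) (fun i => ?_)
      fun i => ((hg i).trans (hopt i).symm).le
    exact ((le_div_iff₀ (hv i)).1 (ciInf_le (Set.finite_range _).bddBelow i)).trans
      (Topt_le_Tpol Q d α g v i)
  · exact growth_le_of_mul_le_Tpol_of_Tpol_le_mul hQ0 hvStar hw (f := f)
      (fun i => (hopt i).le.trans (Topt_le_Tpol Q d α f vStar i)) fun i => (hF i).le
  · refine growth_le_of_mul_le_Tpol_of_Tpol_le_mul hQ0 hw hv (f := f) (fun i => (hF i).ge)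
      fun i => (hgreedy i).le.trans ?_
    exact (div_le_iff₀ (hv i)).1
      (le_ciSup (f := fun i => Topt Q d α v i / v i) (Set.finite_range _).bddAbove i)
end

section
/- (Contraction from positive matrices) Let S be a finite nonempty set, H an S×S real matrix with all entries strictly positive, and v, w : S → ℝ strictly positive vectors. Define γ = min_{i,j∈S} ( H(i,j) v(j) / Σ_{ℓ∈S} H(i,ℓ) v(ℓ) ). Then γ > 0 and for every i ∈ S: (H w)(i)/(H v)(i) ≤ γ · min_{j∈S} w(j)/v(j) + (1 − γ) · max_{j∈S} w(j)/v(j). -/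
/-- A weighted average whose weights are all at least `γ ≥ 0` is at most
`γ * min r + (1 - γ) * max r`. -/
theorem weighted_sum_le_of_le_weights {S : Type*} [Fintype S] [Nonempty S]
    (p r : S → ℝ) {γ : ℝ} (hγ : 0 ≤ γ) (hp : ∀ j, γ ≤ p j) (hp_sum : ∑ j, p j = 1) :
    ∑ j, p j * r j ≤ γ * (⨅ j, r j) + (1 - γ) * (⨆ j, r j) := by
  obtain ⟨k, hk⟩ := exists_eq_ciInf_of_finite (f := r)
  have h_le : ∀ j, r j ≤ ⨆ j, r j := le_ciSup (Set.finite_range r).bddAbove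
  rw [← hk]
  set M := ⨆ j, r j
  have h_gap : γ * (M - r k) ≤ ∑ j, p j * (M - r j) :=
    (mul_le_mul_of_nonneg_right (hp k) (sub_nonneg.2 (h_le k))).trans <|
      Finset.single_le_sum (f := fun j => p j * (M - r j))
        (fun j _ => mul_nonneg (hγ.trans (hp j)) (sub_nonneg.2 (h_le j))) (Finset.mem_univ k)
  simp only [mul_sub, Finset.sum_sub_distrib, ← Finset.sum_mul, hp_sum] at h_gap
  linarith

/-- Contraction from positive matrices: with
`γ = min_{i,j} H(i,j)v(j) / Σ_ℓ H(i,ℓ)v(ℓ)`, we have `γ > 0` and for every `i`,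
`(Hw)(i)/(Hv)(i) ≤ γ min_j w(j)/v(j) + (1-γ) max_j w(j)/v(j)`. -/
theorem contraction_from_positive
    {S : Type*} [Fintype S] [Nonempty S]
    (H : Matrix S S ℝ) (hH : ∀ i j, 0 < H i j)
    (v w : S → ℝ) (hv : ∀ i, 0 < v i) (hw : ∀ i, 0 < w i)
    (γ : ℝ)
    (hγ : γ = ⨅ i : S, ⨅ j : S, H i j * v j / ∑ l, H i l * v l) :
    0 < γ ∧ ∀ i, H.mulVec w i / H.mulVec v i ≤
      γ * (⨅ j, w j / v j) + (1 - γ) * (⨆ j, w j / v j) := by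
  have h_pos : ∀ i, 0 < ∑ l, H i l * v l := fun i =>
    Finset.sum_pos (fun l _ => mul_pos (hH i l) (hv l)) Finset.univ_nonempty
  have hγ_pos : 0 < γ := by
    obtain ⟨i, hi⟩ := exists_eq_ciInf_of_finite
      (f := fun i => ⨅ j, H i j * v j / ∑ l, H i l * v l)
    obtain ⟨j, hj⟩ := exists_eq_ciInf_of_finite
      (f := fun j => H i j * v j / ∑ l, H i l * v l)
    rw [hγ, ← hi, ← hj]
    exact div_pos (mul_pos (hH i j) (hv j)) (h_pos i)
  refine ⟨hγ_pos, fun i => ?_⟩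
  have hγ_le : ∀ j, γ ≤ H i j * v j / ∑ l, H i l * v l := fun j => by
    rw [hγ]
    exact (ciInf_le (Set.finite_range _).bddBelow i).trans
      (ciInf_le (Set.finite_range _).bddBelow j)
  have h_avg : H.mulVec w i / H.mulVec v i =
      ∑ j, H i j * v j / (∑ l, H i l * v l) * (w j / v j) := by
    simp only [Matrix.mulVec, dotProduct]
    rw [Finset.sum_div]
    refine Finset.sum_congr rfl fun j _ => ?_
    have := (hv j).ne'
    have := (h_pos i).ne'
    field_simp
  rw [h_avg]
  refine weighted_sum_le_of_le_weights _ _ hγ_pos.le hγ_le ?_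
  rw [← Finset.sum_div, div_self (h_pos i).ne']
end

section
/- (Lemma 5) Suppose the numbers of partial-evaluation steps are uniformly bounded: there is C with m_k < C for all k. Then there exists β with 0 < β < 1 such that the normalized risk-sensitive MPI iterates satisfy v'_m(i) > β for every m ≥ 0 and every i ∈ S. -/
/-- A finite real family has a positive lower bound, at most `1`, on its positive values. -/
theorem exists_pos_le_of_pos {ι : Type*} [Finite ι] (g : ι → ℝ) :
    ∃ δ : ℝ, 0 < δ ∧ δ ≤ 1 ∧ ∀ x, 0 < g x → δ ≤ g x := by
  classical
  rcases isEmpty_or_nonempty ι with hι | hι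
  · exact ⟨1, one_pos, le_rfl, fun x => isEmptyElim x⟩
  · obtain ⟨x₀, hx₀⟩ := Finite.exists_min fun x => if 0 < g x then min 1 (g x) else 1
    refine ⟨if 0 < g x₀ then min 1 (g x₀) else 1, ?_, ?_, fun x hx => (hx₀ x).trans ?_⟩
    · split_ifs with h
      · exact lt_min one_pos h
      · exact one_pos
    · split_ifs with h
      · exact min_le_left _ _
      · exact le_rfl
    · rw [if_pos hx]
      exact min_le_right _ _

/-- In an irreducible matrix, every proper nonempty set of states is entered by some positive
transition from its complement. -/
theorem exists_ne_zero_of_irreducible {S : Type*} [Fintype S] [DecidableEq S]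
    (M : Matrix S S ℝ) (hM : ∀ i j, ∃ k : ℕ, 1 ≤ k ∧ 0 < (M ^ k) i j)
    (R : Finset S) (hR : R.Nonempty) (hRu : R ≠ Finset.univ) :
    ∃ i ∉ R, ∃ j ∈ R, M i j ≠ 0 := by
  by_contra! h
  obtain ⟨j, hj⟩ := hR
  obtain ⟨i, hi⟩ : ∃ i, i ∉ R := by
    simpa [Finset.eq_univ_iff_forall] using hRu
  have hpow : ∀ k : ℕ, ∀ i ∉ R, (M ^ k) i j = 0 := by
    intro k
    induction k with
    | zero =>
      intro i hi
      rw [pow_zero]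
      exact Matrix.one_apply_ne fun hij => hi (hij ▸ hj)
    | succ k ih =>
      intro i hi
      rw [pow_succ', Matrix.mul_apply]
      refine Finset.sum_eq_zero fun l _ => ?_
      by_cases hl : l ∈ R
      · rw [h i hi l hl, zero_mul]
      · rw [ih l hl, mul_zero]
  obtain ⟨k, -, hk⟩ := hM i j
  exact hk.ne' (hpow k i hi)

/-- If each step loses at most a factor `c` at every state and along every positive transition of
an irreducible matrix, then after `card S` steps every state has at least `c ^ card S` times the
initial value of any given state. -/
theorem pow_card_mul_le_of_irreducible {S : Type*} [Fintype S] [DecidableEq S]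
    (M : ℕ → Matrix S S ℝ) (hM : ∀ n i j, ∃ k : ℕ, 1 ≤ k ∧ 0 < (M n ^ k) i j)
    (u : ℕ → S → ℝ) (c : ℝ) (hc : 0 < c)
    (hdiag : ∀ n i, c * u n i ≤ u (n + 1) i)
    (hstep : ∀ n i j, M n i j ≠ 0 → c * u n j ≤ u (n + 1) i) (j₀ i : S) :
    c ^ Fintype.card S * u 0 j₀ ≤ u (Fintype.card S) i := by
  have key : ∀ n, ∃ R : Finset S, R.Nonempty ∧ min n (Fintype.card S) ≤ R.card ∧
      ∀ i ∈ R, c ^ n * u 0 j₀ ≤ u n i := by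
    intro n
    induction n with
    | zero => exact ⟨{j₀}, by simp, by simp, by simp⟩
    | succ n ih =>
      obtain ⟨R, hne, hcard, hR⟩ := ih
      have hmul : ∀ x, c ^ n * u 0 j₀ ≤ x → c ^ (n + 1) * u 0 j₀ ≤ c * x := fun x hx => by
        rw [pow_succ', mul_assoc]
        exact mul_le_mul_of_nonneg_left hx hc.le
      have hstay : ∀ i ∈ R, c ^ (n + 1) * u 0 j₀ ≤ u (n + 1) i := fun i hi =>
        (hmul _ (hR i hi)).trans (hdiag n i)
      by_cases hRu : R = Finset.univ
      · refine ⟨R, hne, ?_, hstay⟩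
        rw [hRu, Finset.card_univ]
        exact min_le_right _ _
      · obtain ⟨i, hi, j, hj, hij⟩ := exists_ne_zero_of_irreducible (M n) (hM n) R hne hRu
        refine ⟨insert i R, Finset.insert_nonempty _ _, ?_, ?_⟩
        · rw [Finset.card_insert_of_notMem hi]
          omega
        · intro l hl
          rcases Finset.mem_insert.1 hl with rfl | hl
          · exact (hmul _ (hR j hj)).trans (hstep n l j hij)
          · exact hstay l hl
  obtain ⟨R, -, hcard, hR⟩ := key (Fintype.card S)
  rw [min_self] at hcard
  have hRu : R = Finset.univ := (Finset.card_eq_iff_eq_univ R).1 (le_antisymm R.card_le_univ hcard)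
  exact hR i (hRu ▸ Finset.mem_univ i)

section BellmanIterates

variable {S A : Type*} [Fintype S] {Q : S → A → S → ℝ} {d : S → A → ℝ} {α : ℝ}

theorem mul_le_Tpol (hQ0 : ∀ i a j, 0 ≤ Q i a j) {f : S → A} {v : S → ℝ}
    (hv : ∀ i, 0 ≤ v i) (i j : S) :
    Real.exp (α * d i (f i)) * Q i (f i) j * v j ≤ Tpol Q d α f v i := by
  rw [Tpol, mul_assoc]
  exact mul_le_mul_of_nonneg_left
    (Finset.single_le_sum (f := fun j => Q i (f i) j * v j)
      (fun l _ => mul_nonneg (hQ0 _ _ _) (hv l)) (Finset.mem_univ j)) (Real.exp_pos _).le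

theorem Tpol_pos (hQ0 : ∀ i a j, 0 ≤ Q i a j) (hdiag : ∀ i a, 0 < Q i a i) {f : S → A}
    {v : S → ℝ} (hv : ∀ i, 0 < v i) (i : S) : 0 < Tpol Q d α f v i :=
  (mul_pos (mul_pos (Real.exp_pos _) (hdiag i (f i))) (hv i)).trans_le
    (mul_le_Tpol hQ0 (fun i => (hv i).le) i i)

theorem iterate_Tpol_pos (hQ0 : ∀ i a j, 0 ≤ Q i a j) (hdiag : ∀ i a, 0 < Q i a i) {f : S → A}
    {v : S → ℝ} (hv : ∀ i, 0 < v i) (n : ℕ) (i : S) : 0 < (Tpol Q d α f)^[n] v i := by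
  induction n generalizing v with
  | zero => exact hv i
  | succ n ih => exact ih (Tpol_pos hQ0 hdiag hv)

theorem pow_mul_le_iterate_Tpol (hQ0 : ∀ i a j, 0 ≤ Q i a j) (hdiag : ∀ i a, 0 < Q i a i)
    {δ : ℝ} (hδ : 0 < δ) (hδQ : ∀ i a j, 0 < Q i a j → δ ≤ Real.exp (α * d i a) * Q i a j)
    {f : S → A} {v : S → ℝ} (hv : ∀ i, 0 < v i) (n : ℕ) (i : S) :
    δ ^ n * v i ≤ (Tpol Q d α f)^[n] v i := by
  induction n generalizing v with
  | zero => simp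
  | succ n ih =>
    refine le_trans ?_ (ih (Tpol_pos hQ0 hdiag hv))
    rw [pow_succ, mul_assoc]
    exact mul_le_mul_of_nonneg_left
      ((mul_le_mul_of_nonneg_right (hδQ i (f i) i (hdiag i (f i))) (hv i).le).trans
        (mul_le_Tpol hQ0 (fun i => (hv i).le) i i)) (pow_pos hδ n).le

/-- Transitions of positive probability propagate mass through at least one evaluation step. -/
theorem pow_mul_le_iterate_Tpol_of_pos (hQ0 : ∀ i a j, 0 ≤ Q i a j)
    (hdiag : ∀ i a, 0 < Q i a i) {δ : ℝ} (hδ : 0 < δ)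
    (hδQ : ∀ i a j, 0 < Q i a j → δ ≤ Real.exp (α * d i a) * Q i a j)
    {f : S → A} {v : S → ℝ} (hv : ∀ i, 0 < v i) {n : ℕ} (hn : 1 ≤ n) {i j : S}
    (hij : 0 < Q i (f i) j) : δ ^ n * v j ≤ (Tpol Q d α f)^[n] v i := by
  obtain ⟨n, rfl⟩ := Nat.exists_eq_add_of_le' hn
  refine le_trans ?_ (pow_mul_le_iterate_Tpol hQ0 hdiag hδ hδQ (Tpol_pos hQ0 hdiag hv) n i)
  rw [pow_succ, mul_assoc]
  exact mul_le_mul_of_nonneg_left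
    ((mul_le_mul_of_nonneg_right (hδQ i (f i) j hij) (hv j).le).trans
      (mul_le_Tpol hQ0 (fun i => (hv i).le) i j)) (pow_pos hδ n).le

theorem sum_iterate_Tpol_le (hQ0 : ∀ i a j, 0 ≤ Q i a j) (hdiag : ∀ i a, 0 < Q i a i)
    {B : ℝ} (hB : 0 ≤ B) (hBQ : ∀ i a j, Real.exp (α * d i a) * Q i a j ≤ B)
    {f : S → A} {v : S → ℝ} (hv : ∀ i, 0 < v i) (n : ℕ) :
    ∑ i, (Tpol Q d α f)^[n] v i ≤ (Fintype.card S * B) ^ n * ∑ i, v i := by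
  induction n generalizing v with
  | zero => simp
  | succ n ih =>
    refine (ih (Tpol_pos hQ0 hdiag hv)).trans ?_
    rw [pow_succ, mul_assoc]
    refine mul_le_mul_of_nonneg_left ?_ (by positivity)
    have hT : ∀ i, Tpol Q d α f v i ≤ B * ∑ j, v j := fun i => by
      rw [Tpol, Finset.mul_sum, Finset.mul_sum]
      refine Finset.sum_le_sum fun j _ => ?_
      rw [← mul_assoc]
      exact mul_le_mul_of_nonneg_right (hBQ i (f i) j) (hv j).le
    refine (Finset.sum_le_sum fun i _ => hT i).trans_eq ?_
    rw [Finset.sum_const, Finset.card_univ, nsmul_eq_mul, mul_assoc]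

end BellmanIterates

/-- Lemma 5: if the numbers of partial-evaluation steps are uniformly bounded
(`m_k < C` for all `k`), then there is `β ∈ (0,1)` such that the normalized MPI iterates
satisfy `v'_m(i) > β` for every `m` and every state `i`. -/
theorem mpi_iterates_bounded_below
    {S A : Type*} [Fintype S] [Fintype A] [Nonempty S] [Nonempty A] [DecidableEq S]
    (Q : S → A → S → ℝ) (d : S → A → ℝ) (α : ℝ) (hα : 0 < α)
    (hQ0 : ∀ i a j, 0 ≤ Q i a j) (hQ1 : ∀ i a, ∑ j, Q i a j = 1)
    (hdiag : ∀ i a, 0 < Q i a i)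
    (hirr : ∀ f : S → A, ∀ i j : S, ∃ k : ℕ, 1 ≤ k ∧ 0 < ((policyMatrix Q f) ^ k) i j)
    (m : ℕ → ℕ) (hm : ∀ k, 1 ≤ m k) (C : ℕ) (hC : ∀ k, m k < C)
    (v' : ℕ → S → ℝ) (f : ℕ → S → A)
    (hv0pos : ∀ i, 0 < v' 0 i) (hv0sum : ∑ i, v' 0 i = 1)
    (hgreedy : ∀ k i, Tpol Q d α (f (k + 1)) (v' k) i = Topt Q d α (v' k) i)
    (hstep : ∀ k i, v' (k + 1) i =
      (Tpol Q d α (f (k + 1)))^[m k] (v' k) i /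
        ∑ j, (Tpol Q d α (f (k + 1)))^[m k] (v' k) j) :
    ∃ β : ℝ, 0 < β ∧ β < 1 ∧ ∀ (n : ℕ) (i : S), β < v' n i := by
  have hcard : (1 : ℝ) ≤ Fintype.card S := by exact_mod_cast Fintype.card_pos (α := S)
  obtain ⟨δ, hδ, hδ1, hδg⟩ := exists_pos_le_of_pos
    fun x : S × A × S => Real.exp (α * d x.1 x.2.1) * Q x.1 x.2.1 x.2.2
  have hδQ : ∀ i a j, 0 < Q i a j → δ ≤ Real.exp (α * d i a) * Q i a j := fun i a j h =>
    hδg (i, a, j) (mul_pos (Real.exp_pos _) h)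
  obtain ⟨x₁, hx₁⟩ := Finite.exists_max
    fun x : S × A × S => Real.exp (α * d x.1 x.2.1) * Q x.1 x.2.1 x.2.2
  obtain ⟨B, hB1, hBQ⟩ : ∃ B : ℝ, 1 ≤ B ∧ ∀ i a j, Real.exp (α * d i a) * Q i a j ≤ B :=
    ⟨_, le_max_left _ _, fun i a j => (hx₁ (i, a, j)).trans (le_max_right _ _)⟩
  have hB0 : 0 ≤ B := zero_le_one.trans hB1
  set E : ℝ := Fintype.card S * B
  have hE1 : 1 ≤ E := one_le_mul_of_one_le_of_one_le hcard hB1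
  have hinv : ∀ k, (∀ i, 0 < v' k i) ∧ ∑ i, v' k i = 1 := by
    intro k
    induction k with
    | zero => exact ⟨hv0pos, hv0sum⟩
    | succ k ih =>
      have hpos : ∀ i, 0 < (Tpol Q d α (f (k + 1)))^[m k] (v' k) i :=
        iterate_Tpol_pos hQ0 hdiag ih.1 (m k)
      have hsum : 0 < ∑ j, (Tpol Q d α (f (k + 1)))^[m k] (v' k) j :=
        Finset.sum_pos (fun j _ => hpos j) Finset.univ_nonempty
      refine ⟨fun i => hstep k i ▸ div_pos (hpos i) hsum, ?_⟩
      rw [Finset.sum_congr rfl fun i _ => hstep k i, ← Finset.sum_div, div_self hsum.ne']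
  set c : ℝ := δ ^ C / E ^ C
  have hE0 : 0 < E := one_pos.trans_le hE1
  have hc0 : 0 < c := div_pos (pow_pos hδ C) (pow_pos hE0 C)
  have hc1 : c ≤ 1 :=
    div_le_one_of_le₀ ((pow_le_one₀ hδ.le hδ1).trans (one_le_pow₀ hE1)) (pow_pos hE0 C).le
  have hnorm : ∀ k i j, δ ^ m k * v' k j ≤ (Tpol Q d α (f (k + 1)))^[m k] (v' k) i →
      c * v' k j ≤ v' (k + 1) i := by
    intro k i j h
    have hsum : 0 < ∑ j, (Tpol Q d α (f (k + 1)))^[m k] (v' k) j :=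
      Finset.sum_pos (fun j _ => iterate_Tpol_pos hQ0 hdiag (hinv k).1 (m k) j)
        Finset.univ_nonempty
    have hle : ∑ j, (Tpol Q d α (f (k + 1)))^[m k] (v' k) j ≤ E ^ C := by
      refine (sum_iterate_Tpol_le hQ0 hdiag hB0 hBQ (hinv k).1 (m k)).trans ?_
      rw [(hinv k).2, mul_one]
      exact pow_le_pow_right₀ hE1 (hC k).le
    rw [hstep k i, div_mul_eq_mul_div]
    refine div_le_div₀ (iterate_Tpol_pos hQ0 hdiag (hinv k).1 (m k) i).le
      (le_trans ?_ h) hsum hle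
    exact mul_le_mul_of_nonneg_right (pow_le_pow_of_le_one hδ.le hδ1 (hC k).le)
      ((hinv k).1 j).le
  have hstay : ∀ k i, c * v' k i ≤ v' (k + 1) i := fun k i =>
    hnorm k i i (pow_mul_le_iterate_Tpol hQ0 hdiag hδ hδQ (hinv k).1 (m k) i)
  have hmove : ∀ k i j, policyMatrix Q (f (k + 1)) i j ≠ 0 → c * v' k j ≤ v' (k + 1) i :=
    fun k i j hij => hnorm k i j (pow_mul_le_iterate_Tpol_of_pos hQ0 hdiag hδ hδQ (hinv k).1
      (hm k) (lt_of_le_of_ne (hQ0 _ _ _) (Ne.symm hij)))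
  obtain ⟨ε, hε, hε1, hεv⟩ := exists_pos_le_of_pos (v' 0)
  set N := Fintype.card S
  have hlate : ∀ k i, c ^ N * (1 / N) ≤ v' (k + N) i := by
    intro k i
    obtain ⟨j₀, -, hj₀⟩ : ∃ j ∈ Finset.univ, (1 / N : ℝ) ≤ v' k j := by
      refine Finset.exists_le_of_sum_le Finset.univ_nonempty ?_
      rw [(hinv k).2, Finset.sum_const, Finset.card_univ, nsmul_eq_mul]
      rw [mul_one_div_cancel (one_pos.trans_le hcard).ne']
    refine (mul_le_mul_of_nonneg_left hj₀ (pow_pos hc0 N).le).trans ?_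
    exact pow_card_mul_le_of_irreducible (fun n => policyMatrix Q (f (k + n + 1)))
      (fun n => hirr _) (fun n => v' (k + n)) c hc0 (fun n => hstay (k + n))
      (fun n => hmove (k + n)) j₀ i
  have hearly : ∀ n i, c ^ n * ε ≤ v' n i := by
    intro n i
    induction n with
    | zero => simpa using hεv i (hv0pos i)
    | succ n ih =>
      rw [pow_succ', mul_assoc]
      exact (mul_le_mul_of_nonneg_left ih hc0.le).trans (hstay n i)
  have hN : (0 : ℝ) < 1 / N := one_div_pos.2 (one_pos.trans_le hcard)
  have hb : 0 < c ^ N * min (1 / N : ℝ) ε := mul_pos (pow_pos hc0 N) (lt_min hN hε)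
  have hb1 : c ^ N * min (1 / N : ℝ) ε ≤ 1 :=
    mul_le_one₀ (pow_le_one₀ hc0.le hc1) (lt_min hN hε).le ((min_le_right _ _).trans hε1)
  refine ⟨c ^ N * min (1 / N : ℝ) ε / 2, by linarith, by linarith, fun n i => ?_⟩
  refine (half_lt_self hb).trans_le ?_
  rcases le_total N n with h | h
  · obtain ⟨k, rfl⟩ := Nat.exists_eq_add_of_le' h
    exact (mul_le_mul_of_nonneg_left (min_le_left _ _) (pow_pos hc0 N).le).trans (hlate k i)
  · refine le_trans ?_ (hearly n i)
    exact mul_le_mul (pow_le_pow_of_le_one hc0.le hc1 h) (min_le_right _ _)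
      (lt_min hN hε).le (pow_pos hc0 n).le
end

section
/- (Appendix B, Lemma 8, one-step form) Let ε ≥ 1, let v : S → ℝ be strictly positive, and let f be a policy satisfying the approximate policy improvement condition (T v)(i) ≤ (T_f v)(i) ≤ ε (T v)(i) for all i ∈ S. Set l = min_{i∈S} (T v)(i)/v(i) and u = max_{i∈S} (T v)(i)/v(i). Let (λ*, v*) be a solution of the multiplicative Bellman optimality equation and let (λ_f, w) be a Perron pair for f. Then l ≤ λ* ≤ λ_f ≤ ε u. -/
/-- Collatz–Wielandt comparison: if a nonnegative kernel `K` has `a x ≤ K x` and `K y ≤ b y`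
for strictly positive `x`, `y`, then `a ≤ b`. -/
theorem le_of_mul_le_sum_of_sum_le_mul {S : Type*} [Fintype S] [Nonempty S]
    (K : S → S → ℝ) (hK : ∀ i j, 0 ≤ K i j) {x y : S → ℝ} (hx : ∀ i, 0 < x i)
    (hy : ∀ i, 0 < y i) {a b : ℝ} (hax : ∀ i, a * x i ≤ ∑ j, K i j * x j)
    (hby : ∀ i, ∑ j, K i j * y j ≤ b * y i) : a ≤ b := by
  obtain ⟨i, hi⟩ := Finite.exists_max fun i => x i / y i
  have hc : 0 < x i / y i := div_pos (hx i) (hy i)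
  have hxy : ∀ j, x j ≤ x i / y i * y j := fun j => (div_le_iff₀ (hy j)).1 (hi j)
  refine le_of_mul_le_mul_right ?_ (hx i)
  calc a * x i ≤ ∑ j, K i j * x j := hax i
    _ ≤ ∑ j, K i j * (x i / y i * y j) :=
      Finset.sum_le_sum fun j _ => mul_le_mul_of_nonneg_left (hxy j) (hK i j)
    _ = x i / y i * ∑ j, K i j * y j := by
      rw [Finset.mul_sum]
      exact Finset.sum_congr rfl fun j _ => by ring
    _ ≤ x i / y i * (b * y i) := mul_le_mul_of_nonneg_left (hby i) hc.le
    _ = b * x i := by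
      have := (hy i).ne'
      field_simp

theorem sum_exp_mul_eq_Tpol {S A : Type*} [Fintype S]
    (Q : S → A → S → ℝ) (d : S → A → ℝ) (α : ℝ) (f : S → A) (v : S → ℝ) (i : S) :
    ∑ j, (Real.exp (α * d i (f i)) * Q i (f i) j) * v j = Tpol Q d α f v i := by
  simp only [Tpol, Finset.mul_sum, mul_assoc]

/-- Existence of a greedy policy. -/
theorem exists_Tpol_eq_Topt {S A : Type*} [Fintype S] [Finite A] [Nonempty A]
    (Q : S → A → S → ℝ) (d : S → A → ℝ) (α : ℝ) (v : S → ℝ) :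
    ∃ g : S → A, ∀ i, Tpol Q d α g v i = Topt Q d α v i := by
  have h : ∀ i, ∃ a : A, Real.exp (α * d i a) * ∑ j, Q i a j * v j = Topt Q d α v i :=
    fun i => exists_eq_ciInf_of_finite
  choose g hg using h
  exact ⟨g, hg⟩

/-- Appendix B, Lemma 8 (one-step form): if `f` satisfies the approximate policy
improvement condition `(Tv)(i) ≤ (T_f v)(i) ≤ ε (Tv)(i)`, then with
`l = min_i (Tv)(i)/v(i)` and `u = max_i (Tv)(i)/v(i)` we have `l ≤ λ* ≤ λ_f ≤ ε u`. -/
theorem approx_mpi_sandwich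
    {S A : Type*} [Fintype S] [Fintype A] [Nonempty S] [Nonempty A]
    (Q : S → A → S → ℝ) (d : S → A → ℝ) (α : ℝ) (hα : 0 < α)
    (hQ0 : ∀ i a j, 0 ≤ Q i a j) (hQ1 : ∀ i a, ∑ j, Q i a j = 1)
    (ε : ℝ) (hε : 1 ≤ ε)
    (v : S → ℝ) (hv : ∀ i, 0 < v i)
    (f : S → A)
    (himp : ∀ i, Topt Q d α v i ≤ Tpol Q d α f v i ∧
      Tpol Q d α f v i ≤ ε * Topt Q d α v i)
    (lamStar : ℝ) (vStar : S → ℝ)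
    (hlamStar : 0 < lamStar) (hvStar : ∀ i, 0 < vStar i)
    (hopt : ∀ i, lamStar * vStar i = Topt Q d α vStar i)
    (lamF : ℝ) (w : S → ℝ)
    (hlamF : 0 < lamF) (hw : ∀ i, 0 < w i)
    (hPerron : ∀ i, ∑ j, (Real.exp (α * d i (f i)) * Q i (f i) j) * w j = lamF * w i) :
    (⨅ i, Topt Q d α v i / v i) ≤ lamStar ∧ lamStar ≤ lamF ∧
      lamF ≤ ε * ⨆ i, Topt Q d α v i / v i := by
  have hK : ∀ (g : S → A) (i j : S), 0 ≤ Real.exp (α * d i (g i)) * Q i (g i) j :=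
    fun g i j => mul_nonneg (Real.exp_pos _).le (hQ0 _ _ _)
  refine ⟨?_, ?_, ?_⟩
  · obtain ⟨g, hg⟩ := exists_Tpol_eq_Topt Q d α vStar
    refine le_of_mul_le_sum_of_sum_le_mul _ (hK g) hv hvStar (fun i => ?_) fun i => ?_
    · rw [sum_exp_mul_eq_Tpol]
      exact ((le_div_iff₀ (hv i)).1 (ciInf_le (Set.finite_range _).bddBelow i)).trans
        (Topt_le_Tpol Q d α g v i)
    · rw [sum_exp_mul_eq_Tpol, hg, hopt]
  · refine le_of_mul_le_sum_of_sum_le_mul _ (hK f) hvStar hw (fun i => ?_)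
      fun i => (hPerron i).le
    rw [sum_exp_mul_eq_Tpol, hopt]
    exact Topt_le_Tpol Q d α f vStar i
  · refine le_of_mul_le_sum_of_sum_le_mul _ (hK f) hw hv (fun i => (hPerron i).ge) fun i => ?_
    rw [sum_exp_mul_eq_Tpol, mul_assoc]
    refine (himp i).2.trans (mul_le_mul_of_nonneg_left ?_ (zero_le_one.trans hε))
    exact (div_le_iff₀ (hv i)).1
      (le_ciSup (f := fun i => Topt Q d α v i / v i) (Set.finite_range _).bddAbove i)
end
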